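/- arXiv:1602.00353 — 15 statements merged into one kernel-verified Lean document; each statement's English description precedes it below -/
import Mathlib

section
/- Let (A,T,n) be a meta-tangible T-triple with unique quasi-negatives such that T is a group under multiplication. Then at least one of the following holds: (i) (A,T,n) is (−)-bipotent; or (ii) e' = 1 (that is, 1 + (1 + n(1)) = 1), and moreover in this case, if n is of the first kind then 1+1+1 = 1 and every element of A is 0, an element of T, or a sum of two elements of T. -/
/-- Theorem 7.21: a meta-tangible T-group-module triple is either (−)-bipotent,
or satisfies e' = 1, in which case if (−) is of the first kind then 1+1+1 = 1
and A has height ≤ 2. -/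
theorem stmt0 {A : Type*} [CommSemiring A] (n : A → A) (T : Set A)
    (hadd : ∀ x y : A, n (x + y) = n x + n y)
    (hinv : ∀ x : A, n (n x) = x)
    (hmul : ∀ x y : A, n (x * y) = n x * y)
    (hone : (1 : A) ∈ T)
    (hTmul : ∀ a ∈ T, ∀ b ∈ T, a * b ∈ T)
    (hTn : ∀ a ∈ T, n a ∈ T)
    (hdisj : ∀ a ∈ T, ¬ ∃ x : A, a = x + n x)
    (hgen : ∀ c : A, c ≠ 0 → ∃ l : List A, (∀ x ∈ l, x ∈ T) ∧ l.sum = c)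
    (huq : ∀ a ∈ T, ∀ b ∈ T, (∃ x : A, a + b = x + n x) → b = n a)
    (hmt : ∀ a ∈ T, ∀ b ∈ T, b ≠ n a → a + b ∈ T)
    (hgrp : ∀ t ∈ T, ∃ s ∈ T, t * s = 1) :
    (∀ a ∈ T, ∀ b ∈ T, b ≠ n a → a + b = a ∨ a + b = b) ∨
    ((1 : A) + (1 + n 1) = 1 ∧
      ((∀ a ∈ T, n a = a) →
        ((1 : A) + 1 + 1 = 1 ∧
          ∀ c : A, c = 0 ∨ c ∈ T ∨ ∃ a ∈ T, ∃ b ∈ T, c = a + b))) := by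
  have ninj : ∀ {x y : A}, n x = n y → x = y := fun {x y} h => by
    rw [← hinv x, h, hinv]
  have nmul : ∀ x : A, n x = n 1 * x := fun x => by rw [← hmul, one_mul]
  refine or_iff_not_imp_left.2 fun hb => ?_
  have he : (1 : A) + (1 + n 1) = 1 := by
    push Not at hb
    obtain ⟨a, ha, b, hbT, hba, h1, h2⟩ := hb
    obtain ⟨s, hs, has⟩ := hgrp a ha
    -- Rescale the failure of bipotence to a pair `1, c`.
    obtain ⟨c, hc, rfl⟩ : ∃ c ∈ T, b = a * c :=
      ⟨s * b, hTmul s hs b hbT, by rw [← mul_assoc, has, one_mul]⟩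
    have hc1 : c ≠ n 1 := by
      rintro rfl
      exact hba (by rw [nmul a, mul_comm])
    have hd1 : 1 + c ≠ 1 := fun h => h1 (by simpa [mul_add] using congrArg (a * ·) h)
    have hdc : 1 + c ≠ c := fun h => h2 (by simpa [mul_add] using congrArg (a * ·) h)
    have hd : 1 + c ∈ T := hmt 1 hone c hc hc1
    have key₁ : 1 + c + n 1 = c := by
      have hf := hmt _ hd (n 1) (hTn 1 hone) fun h => hd1 (ninj h).symm
      refine (ninj (huq _ hf (n c) (hTn c hc) ⟨1 + c, ?_⟩)).symm
      rw [hadd, add_assoc (1 + c)]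
    have key₂ : 1 + c + n c = 1 := by
      have hf := hmt _ hd (n c) (hTn c hc) fun h => hdc (ninj h).symm
      refine (ninj (huq _ hf (n 1) (hTn 1 hone) ⟨1 + c, ?_⟩)).symm
      rw [hadd, add_assoc (1 + c), add_comm (n c)]
    by_cases hn : n 1 = 1
    · rw [nmul c, hn, one_mul] at key₂
      rw [hn] at key₁ ⊢
      have h2c : (1 : A) + 1 = c + c := by
        calc (1 : A) + 1 = 1 + (1 + c + c) := by rw [key₂]
          _ = (1 + c + 1) + c := by ac_rfl
          _ = c + c := by rw [key₁]
      rw [h2c, ← add_assoc, key₂]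
    · have h2T : (1 : A) + 1 ∈ T := hmt 1 hone 1 hone (Ne.symm hn)
      by_cases h2 : (1 : A) + 1 = 1
      · refine absurd ?_ hdc
        calc 1 + c = 1 + (1 + c + n 1) := by rw [key₁]
          _ = (1 + 1) + c + n 1 := by ac_rfl
          _ = c := by rw [h2, key₁]
      · have hf := hmt _ h2T (n 1) (hTn 1 hone) fun h => h2 (ninj h).symm
        rw [← add_assoc]
        refine (ninj (huq _ hf (n 1) (hTn 1 hone) ⟨1 + 1, ?_⟩)).symm
        rw [hadd, add_assoc (1 + 1)]
  refine ⟨he, fun hfirst => ?_⟩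
  rw [hfirst 1 hone, ← add_assoc] at he
  have add_mem : ∀ a ∈ T, ∀ b ∈ T, a ≠ b → a + b ∈ T := fun a ha b hb hab =>
    hmt a ha b hb (by rw [hfirst a ha]; exact hab.symm)
  refine ⟨he, fun c => ?_⟩
  by_cases hc : c = 0
  · exact .inl hc
  obtain ⟨l, hl, rfl⟩ := hgen c hc
  clear hc
  induction l with
  | nil => exact .inl rfl
  | cons a l ih =>
    have ha : a ∈ T := hl a List.mem_cons_self
    rw [List.sum_cons]
    rcases ih fun x hx => hl x (List.mem_cons_of_mem a hx) with h | h | ⟨x, hx, y, hy, h⟩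
    · exact .inr (.inl (by rwa [h, add_zero]))
    · exact .inr (.inr ⟨a, ha, _, h, rfl⟩)
    · rw [h]
      by_cases hax : a = x
      · by_cases hay : a = y
        · subst hax hay
          have h3 : a + (a + a) = a := by
            simpa [mul_add, add_assoc] using congrArg (a * ·) he
          exact .inr (.inl (by rwa [h3]))
        · exact .inr (.inr ⟨a + y, add_mem a ha y hy hay, x, hx, by ac_rfl⟩)
      · exact .inr (.inr ⟨a + x, add_mem a ha x hx hax, y, hy, by ac_rfl⟩)
end

section
/- Let (A,T,n) be a meta-tangible T-triple with unique quasi-negatives such that T is a group under multiplication. Then every element of A of positive height has a uniform presentation: if c ∈ A is a sum of m elements of T (m ≥ 1) but is not a sum of fewer than m elements of T, then either (m = 1 and c ∈ T), or (m = 2 and c = t + n(t) for some t ∈ T), or (m ≥ 3 and there exists t ∈ T with c = m•t, n(t) = t, and 1+1+1 ≠ 1 in A). -/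
/-- In a shortest presentation of an element as a sum of tangibles, any two summands are
quasi-negatives of each other. -/
theorem eq_neg_of_perm_of_minimal {A : Type*} [AddCommMonoid A] {n : A → A} {T : Set A}
    (hmt : ∀ a ∈ T, ∀ b ∈ T, b ≠ n a → a + b ∈ T) {l : List A} (hl : ∀ x ∈ l, x ∈ T)
    (hmin : ∀ l' : List A, (∀ x ∈ l', x ∈ T) → l'.sum = l.sum → l.length ≤ l'.length)
    {a b : A} {r : List A} (h : l.Perm (a :: b :: r)) : b = n a := by
  by_contra hb
  have hT : ∀ x ∈ a :: b :: r, x ∈ T := fun x hx => hl x (h.mem_iff.2 hx)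
  have hab : a + b ∈ T := hmt a (hT a (by simp)) b (hT b (by simp)) hb
  have hlen := hmin ((a + b) :: r)
    (by
      intro x hx
      rcases List.mem_cons.1 hx with rfl | hx
      · exact hab
      · exact hT x (by simp [hx]))
    (by rw [h.sum_eq]; simp [add_assoc])
  rw [h.length_eq] at hlen
  simp at hlen


/-- Theorem 7.28: every element of positive height in a meta-tangible
T-group-module triple has a uniform presentation. -/
theorem stmt1 {A : Type*} [CommSemiring A] (n : A → A) (T : Set A)
    (hadd : ∀ x y : A, n (x + y) = n x + n y)
    (hinv : ∀ x : A, n (n x) = x)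
    (hmul : ∀ x y : A, n (x * y) = n x * y)
    (hone : (1 : A) ∈ T)
    (hTmul : ∀ a ∈ T, ∀ b ∈ T, a * b ∈ T)
    (hTn : ∀ a ∈ T, n a ∈ T)
    (hdisj : ∀ a ∈ T, ¬ ∃ x : A, a = x + n x)
    (hgen : ∀ c : A, c ≠ 0 → ∃ l : List A, (∀ x ∈ l, x ∈ T) ∧ l.sum = c)
    (huq : ∀ a ∈ T, ∀ b ∈ T, (∃ x : A, a + b = x + n x) → b = n a)
    (hmt : ∀ a ∈ T, ∀ b ∈ T, b ≠ n a → a + b ∈ T)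
    (hgrp : ∀ t ∈ T, ∃ s ∈ T, t * s = 1)
    (c : A) (m : ℕ) (hm : 1 ≤ m)
    (hc : ∃ l : List A, l.length = m ∧ (∀ x ∈ l, x ∈ T) ∧ l.sum = c)
    (hmin : ∀ l : List A, (∀ x ∈ l, x ∈ T) → l.sum = c → m ≤ l.length) :
    (m = 1 ∧ c ∈ T) ∨
    (m = 2 ∧ ∃ t ∈ T, c = t + n t) ∨
    (3 ≤ m ∧ ∃ t ∈ T, c = m • t ∧ n t = t ∧ (1 : A) + 1 + 1 ≠ 1) := by
  obtain ⟨l, rfl, hl, rfl⟩ := hc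
  have key {a b : A} {r : List A} (h : l.Perm (a :: b :: r)) : b = n a :=
    eq_neg_of_perm_of_minimal hmt hl hmin h
  match l, hm, hl, hmin, @key with
  | [x], _, hl, _, _ => exact Or.inl ⟨rfl, by simpa using hl⟩
  | [x, y], _, hl, _, key =>
    refine Or.inr (Or.inl ⟨rfl, x, hl x (by simp), ?_⟩)
    simp [key (List.Perm.refl [x, y])]
  | x :: y :: z :: r, _, hl, hmin, key =>
    have hy : y = n x := key (List.Perm.refl _)
    have hw : ∀ w ∈ z :: r, w = n x ∧ w = x := by
      intro w hw
      obtain ⟨s, hs⟩ : ∃ s, (z :: r).Perm (w :: s) := by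
        classical exact ⟨_, List.perm_cons_erase hw⟩
      refine ⟨key (r := y :: s) (((hs.cons y).trans (List.Perm.swap w y s)).cons x), ?_⟩
      have h : w = n y := key (r := x :: s)
        ((List.Perm.swap y x _).trans (((hs.cons x).trans (List.Perm.swap w x s)).cons y))
      rw [h, hy, hinv]
    have hx : n x = x := (hw z (by simp)).1.symm.trans (hw z (by simp)).2
    have hall : ∀ w ∈ x :: y :: z :: r, w = x := by
      intro w h
      rcases List.mem_cons.1 h with h | h
      · exact h
      rcases List.mem_cons.1 h with h | h
      · rw [h, hy, hx]
      · exact (hw w h).2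
    have hsum := List.sum_eq_card_nsmul _ x hall
    refine Or.inr (Or.inr ⟨by simp, x, hl x (by simp), hsum, hx, fun h3 => ?_⟩)
    have hxxx : x + x + x = x := by
      simpa [add_mul] using congrArg (· * x) h3
    have hlen := hmin (List.replicate (r.length + 1) x)
      (fun w h => by rw [List.eq_of_mem_replicate h]; exact hl x (by simp))
      (by
        rw [hsum, List.sum_replicate]
        simp only [List.length_cons, succ_nsmul]
        rw [add_assoc, add_assoc, ← add_assoc x x x, hxxx])
    simp at hlen
end

section
/- If (aᵢ)_{i∈I}, (a'ᵢ)_{i∈I'}, and (bⱼ)_{j∈J} are finite families of elements of T with ∑_{i∈I} aᵢ = ∑_{i∈I'} a'ᵢ in A, then ∑_{i∈I}∑_{j∈J} aᵢ·bⱼ = ∑_{i∈I'}∑_{j∈J} a'ᵢ·bⱼ. (Hence the product (∑ᵢ aᵢ)·(∑ⱼ bⱼ) := ∑_{i,j} aᵢ·bⱼ is well defined on the additive span of T, making it a semiring; this is the content of the theorem that any T-monoid bimodule generated additively by T can be made uniquely into a T-semiring.) -/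
/-- A double sum of products over `T` depends on the first family only through its sum. -/
theorem sum_map_sum_map_eq_sum_map_sum {A : Type*} [AddCommMonoid A] (T : Set A)
    (smul : A → A → A)
    (hdist : ∀ t ∈ T, ∀ x y : A, smul t (x + y) = smul t x + smul t y)
    (hzero : ∀ t ∈ T, smul t 0 = 0)
    (hcomm : ∀ t ∈ T, ∀ s ∈ T, smul t s = smul s t)
    (la lb : List A) (hla : ∀ x ∈ la, x ∈ T) (hlb : ∀ x ∈ lb, x ∈ T) :
    (la.map (fun a => (lb.map (fun b => smul a b)).sum)).sum
      = (lb.map (fun b => smul b la.sum)).sum := by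
  induction la with
  | nil =>
    have h : lb.map (fun b => smul b 0) = lb.map (fun _ => 0) :=
      List.map_congr_left fun b hb => hzero b (hlb b hb)
    simp [h]
  | cons a la ih =>
    have h : lb.map (fun b => smul b (a + la.sum))
        = lb.map (fun b => smul a b + smul b la.sum) :=
      List.map_congr_left fun b hb => by
        rw [hdist b (hlb b hb), hcomm b (hlb b hb) a (hla a (by simp))]
    rw [List.map_cons, List.sum_cons, List.sum_cons, h, List.sum_map_add,
      ih fun x hx => hla x (List.mem_cons_of_mem a hx)]

/-- Theorem 2.5 (well-definedness of the product): if two finite families of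
elements of T have the same sum, then the corresponding double sums of
products against a third family agree. -/
theorem stmt4 {A : Type*} [AddCommMonoid A] (T : Set A) (smul : A → A → A)
    (hdist : ∀ t ∈ T, ∀ x y : A, smul t (x + y) = smul t x + smul t y)
    (hzero : ∀ t ∈ T, smul t 0 = 0)
    (hcomm : ∀ t ∈ T, ∀ s ∈ T, smul t s = smul s t)
    (la la' lb : List A)
    (hla : ∀ x ∈ la, x ∈ T) (hla' : ∀ x ∈ la', x ∈ T) (hlb : ∀ x ∈ lb, x ∈ T)
    (hsum : la.sum = la'.sum) :
    (la.map (fun a => (lb.map (fun b => smul a b)).sum)).sum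
      = (la'.map (fun a => (lb.map (fun b => smul a b)).sum)).sum := by
  rw [sum_map_sum_map_eq_sum_map_sum T smul hdist hzero hcomm la lb hla hlb,
    sum_map_sum_map_eq_sum_map_sum T smul hdist hzero hcomm la' lb hla' hlb, hsum]
end

section
/- For all k×k matrices M and N over A, det_n(M)·det_n(N) ⪯∘ det_n(M·N); that is, there exists c ∈ A with det_n(M·N) = det_n(M)·det_n(N) + (c + n(c)). -/
/-- The (−)-determinant of a k×k matrix: the sum over even permutations of the
products of entries, plus the negation of the sum over odd permutations. -/
def detn {A : Type*} [CommSemiring A] (n : A → A) {k : ℕ}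
    (M : Matrix (Fin k) (Fin k) A) : A :=
  (∑ σ ∈ Finset.univ.filter (fun σ : Equiv.Perm (Fin k) => Equiv.Perm.sign σ = 1),
      ∏ i, M (σ i) i)
  + n (∑ σ ∈ Finset.univ.filter (fun σ : Equiv.Perm (Fin k) => Equiv.Perm.sign σ = -1),
      ∏ i, M (σ i) i)

/-- The image of a sign in a semiring with a negation map `n`: `1 ↦ 1` and `-1 ↦ n 1`. -/
def negSign {A : Type*} [CommSemiring A] (n : A → A) (u : ℤˣ) : A :=
  if u = 1 then 1 else n 1

section NegationMap

variable {A : Type*} [CommSemiring A] {n : A → A} {k : ℕ}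

theorem negMap_eq_mul (hmul : ∀ x y : A, n (x * y) = n x * y) (x : A) : n x = n 1 * x := by
  rw [← hmul, one_mul]

theorem negSign_mul (hinv : ∀ x : A, n (n x) = x) (hmul : ∀ x y : A, n (x * y) = n x * y)
    (u v : ℤˣ) : negSign n (u * v) = negSign n u * negSign n v := by
  have h : n 1 * n 1 = 1 := by rw [← negMap_eq_mul hmul, hinv]
  rcases Int.units_eq_one_or u with rfl | rfl <;> rcases Int.units_eq_one_or v with rfl | rfl <;>
    simp [negSign, h]

theorem detn_eq_sum_negSign (hmul : ∀ x y : A, n (x * y) = n x * y)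
    (M : Matrix (Fin k) (Fin k) A) :
    detn n M = ∑ σ : Equiv.Perm (Fin k), negSign n (Equiv.Perm.sign σ) * ∏ i, M (σ i) i := by
  have h : (Finset.univ.filter fun σ : Equiv.Perm (Fin k) => Equiv.Perm.sign σ = -1) =
      Finset.univ.filter fun σ : Equiv.Perm (Fin k) => ¬ Equiv.Perm.sign σ = 1 := by
    ext σ
    rcases Int.units_eq_one_or (Equiv.Perm.sign σ) with h | h <;> simp [h]
  rw [detn, negMap_eq_mul hmul, h, Finset.mul_sum,
    ← Finset.sum_filter_add_sum_filter_not Finset.univ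
      fun σ : Equiv.Perm (Fin k) => Equiv.Perm.sign σ = 1]
  congr 1
  · refine Finset.sum_congr rfl fun σ hσ => ?_
    rw [negSign, if_pos (Finset.mem_filter.1 hσ).2, one_mul]
  · refine Finset.sum_congr rfl fun σ hσ => ?_
    rw [negSign, if_neg (Finset.mem_filter.1 hσ).2]

theorem detn_submatrix_perm (hinv : ∀ x : A, n (n x) = x)
    (hmul : ∀ x y : A, n (x * y) = n x * y) (M : Matrix (Fin k) (Fin k) A)
    (τ : Equiv.Perm (Fin k)) :
    detn n (M.submatrix id τ) = negSign n (Equiv.Perm.sign τ) * detn n M := by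
  rw [detn_eq_sum_negSign hmul, detn_eq_sum_negSign hmul, Finset.mul_sum,
    ← Equiv.sum_comp (Equiv.mulRight τ)]
  refine Finset.sum_congr rfl fun σ _ => ?_
  rw [Equiv.coe_mulRight, Equiv.Perm.sign_mul, negSign_mul hinv hmul,
    ← Equiv.prod_comp τ fun i => M (σ i) i]
  simp only [Matrix.submatrix_apply, Equiv.Perm.mul_apply, id]
  ring

/-- The (−)-determinant of a matrix with a repeated column is a quasi-zero. -/
theorem exists_detn_submatrix_eq_add_neg (M : Matrix (Fin k) (Fin k) A) {f : Fin k → Fin k}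
    (hf : ¬ Function.Injective f) : ∃ c : A, detn n (M.submatrix id f) = c + n c := by
  obtain ⟨i, j, hij, hne⟩ : ∃ i j, f i = f j ∧ i ≠ j := by
    simpa [Function.Injective] using hf
  have hswap : ∀ l, f (Equiv.swap i j l) = f l := fun l => by
    by_cases hi : l = i
    · simp [hi, hij]
    by_cases hj : l = j
    · simp [hj, hij]
    rw [Equiv.swap_apply_of_ne_of_ne hi hj]
  refine ⟨_, congrArg (_ + n ·) ?_⟩
  refine Finset.sum_nbij' (· * Equiv.swap i j) (· * Equiv.swap i j) ?_ ?_ ?_ ?_ ?_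
  · intro σ hσ
    simpa [Equiv.Perm.sign_swap hne, neg_eq_iff_eq_neg] using hσ
  · intro σ hσ
    simpa [Equiv.Perm.sign_swap hne] using hσ
  · intro σ _
    simp [mul_assoc]
  · intro σ _
    simp [mul_assoc]
  · intro σ _
    rw [← Equiv.prod_comp (Equiv.swap i j)]
    simp [hswap]

theorem detn_mul_eq_sum (hmul : ∀ x y : A, n (x * y) = n x * y)
    (M N : Matrix (Fin k) (Fin k) A) :
    detn n (M * N) =
      ∑ f : Fin k → Fin k, detn n (M.submatrix id f) * ∏ i, N (f i) i := by
  simp only [detn_eq_sum_negSign hmul, Matrix.mul_apply, Finset.prod_univ_sum, Finset.mul_sum,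
    Fintype.piFinset_univ, Finset.sum_mul, Matrix.submatrix_apply, id]
  rw [Finset.sum_comm]
  simp only [Finset.prod_mul_distrib, mul_assoc]

theorem sum_injective_detn_submatrix (hinv : ∀ x : A, n (n x) = x)
    (hmul : ∀ x y : A, n (x * y) = n x * y) (M N : Matrix (Fin k) (Fin k) A) :
    ∑ f : Fin k → Fin k with Function.Injective f,
      detn n (M.submatrix id f) * ∏ i, N (f i) i = detn n M * detn n N := by
  rw [detn_eq_sum_negSign hmul N, Finset.mul_sum]
  symm
  refine Finset.sum_bij (fun τ _ => ⇑τ) ?_ ?_ ?_ ?_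
  · intro τ _
    simpa using τ.injective
  · intro σ _ τ _ h
    exact DFunLike.coe_injective h
  · intro f hf
    exact ⟨Equiv.ofBijective f (Finite.injective_iff_bijective.1 (Finset.mem_filter.1 hf).2),
      Finset.mem_univ _, rfl⟩
  · intro τ _
    rw [detn_submatrix_perm hinv hmul]
    ring

end NegationMap

/-- Theorem 8.22: |A||B| ⪯∘ |AB| for matrices over a commutative semiring
with a negation map. -/
theorem stmt6 {A : Type*} [CommSemiring A] (n : A → A)
    (hadd : ∀ x y : A, n (x + y) = n x + n y)
    (hinv : ∀ x : A, n (n x) = x)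
    (hmul : ∀ x y : A, n (x * y) = n x * y)
    (k : ℕ) (M N : Matrix (Fin k) (Fin k) A) :
    ∃ c : A, detn n (M * N) = detn n M * detn n N + (c + n c) := by
  choose! c hc using fun (f : Fin k → Fin k) (hf : ¬ Function.Injective f) =>
    exists_detn_submatrix_eq_add_neg (n := n) M hf
  refine ⟨∑ f : Fin k → Fin k with ¬ Function.Injective f, c f * ∏ i, N (f i) i, ?_⟩
  rw [detn_mul_eq_sum hmul, ← sum_injective_detn_submatrix hinv hmul,
    ← Finset.sum_filter_add_sum_filter_not Finset.univ Function.Injective,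
    negMap_eq_mul hmul (∑ f with _, _), Finset.mul_sum, ← Finset.sum_add_distrib]
  congr 1
  refine Finset.sum_congr rfl fun f hf => ?_
  rw [hc f (Finset.mem_filter.1 hf).2, add_mul, negMap_eq_mul hmul (c f), mul_assoc]
end

section
/- Under these hypotheses, the weak laws are equalities: a•(x+y) = a•x + a•y and (a·a')•b = a•(a'•b) for all a,a' ∈ T and b,x,y ∈ A; that is, A is a genuine T-group module. -/
/-- Proposition 6.42: if a group T acts weakly on an ordered additive monoid A
with a⁻¹•(a•b) = b, then the weak laws are equalities, i.e., A is a genuine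
T-group module. -/
theorem stmt8 {T : Type*} [Group T] {A : Type*} [AddCommMonoid A] [PartialOrder A]
    (haddle : ∀ x y z : A, x ≤ y → x + z ≤ y + z)
    (sm : T → A → A)
    (honesm : ∀ b : A, sm 1 b = b)
    (hmono : ∀ (a : T) (x y : A), x ≤ y → sm a x ≤ sm a y)
    (hassoc : ∀ (a a' : T) (b : A), sm (a * a') b ≤ sm a (sm a' b))
    (hdist : ∀ (a : T) (x y : A), sm a (x + y) ≤ sm a x + sm a y)
    (hcancel : ∀ (a : T) (b : A), sm a⁻¹ (sm a b) = b) :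
    (∀ (a : T) (x y : A), sm a (x + y) = sm a x + sm a y) ∧
    (∀ (a a' : T) (b : A), sm (a * a') b = sm a (sm a' b)) := by
  have hcancel' (a : T) (b : A) : sm a (sm a⁻¹ b) = b := by
    simpa using hcancel a⁻¹ b
  refine ⟨fun a x y => (hdist a x y).antisymm ?_, fun a a' b => (hassoc a a' b).antisymm ?_⟩
  · have h := hmono a _ _ (hdist a⁻¹ (sm a x) (sm a y))
    rwa [hcancel', hcancel, hcancel] at h
  · have h := hmono a _ _ (hassoc a⁻¹ (a * a') b)
    rwa [hcancel', inv_mul_cancel_left] at h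
end

section
/- Under these fuzzy T-ring hypotheses: (a) A° ⊆ A₀, i.e., c + ε·c ∈ A₀ for every c ∈ A; (b) T ∩ A° = ∅; and (c) the triple (A,T,n) with n(x) = ε·x has unique quasi-negatives: for all a,b ∈ T, if a + b = c + ε·c for some c ∈ A, then b = ε·a. -/
/-- Proposition 14.7: any coherent fuzzy T-ring gives rise to a T-triple
with unique quasi-negatives, where n(a) = ε·a, and A° ⊆ A₀. -/
theorem stmt9 {A : Type*} [CommSemiring A] (T : Set A) (ε : A) (A0 : Set A)
    (honeT : (1 : A) ∈ T)
    (hTmul : ∀ a ∈ T, ∀ b ∈ T, a * b ∈ T)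
    (hcanc : ∀ t ∈ T, ∀ x y : A, t * x = t * y → x = y)
    (hεT : ε ∈ T)
    (hε2 : ε * ε = 1)
    (h0 : (0 : A) ∈ A0)
    (haddA0 : ∀ x ∈ A0, ∀ y ∈ A0, x + y ∈ A0)
    (hTA0 : ∀ t ∈ T, ∀ x ∈ A0, t * x ∈ A0)
    (hdisj : ∀ t ∈ T, t ∉ A0)
    (hfuzzy : ∀ a ∈ T, ∀ b ∈ T, (a + b ∈ A0 ↔ a = ε * b))
    (hgen : ∀ c : A, ∃ l : List A, (∀ x ∈ l, x ∈ T) ∧ l.sum = c) :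
    (∀ c : A, c + ε * c ∈ A0) ∧
    (∀ t ∈ T, ¬ ∃ c : A, t = c + ε * c) ∧
    (∀ a ∈ T, ∀ b ∈ T, (∃ c : A, a + b = c + ε * c) → b = ε * a) := by
  have hinv : ∀ x : A, ε * (ε * x) = x := fun x => by rw [← mul_assoc, hε2, one_mul]
  have hquasi : ∀ c : A, c + ε * c ∈ A0 := by
    intro c
    obtain ⟨l, hl, rfl⟩ := hgen c
    induction l with
    | nil => simpa using h0
    | cons x l ih =>
      have hx : x ∈ T := hl x List.mem_cons_self
      have hhead : x + ε * x ∈ A0 := (hfuzzy x hx _ (hTmul ε hεT x hx)).2 (hinv x).symm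
      have htail := ih fun y hy => hl y (List.mem_cons_of_mem x hy)
      rw [List.sum_cons, mul_add, add_add_add_comm]
      exact haddA0 _ hhead _ htail
  refine ⟨hquasi, ?_, ?_⟩
  · rintro t ht ⟨c, rfl⟩
    exact hdisj _ ht (hquasi c)
  · rintro a ha b hb ⟨c, hc⟩
    have hab : a = ε * b := (hfuzzy a ha b hb).1 (hc ▸ hquasi c)
    rw [hab, hinv]
end

section
/- For all a,b,c ∈ S: [a,b]·c + b·[a,c] = [a, b·c] + (b·a·c)°, and likewise a·[b,c] + [a,c]·b = [a·b, c] + (a·c·b)°. In particular [a,b]·c + b·[a,c] ⪰∘ [a, b·c] and a·[b,c] + [a,c]·b ⪰∘ [a·b, c], where y ⪰∘ x means y = x + z° for some z ∈ S. -/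
/-- Lemma 4.2 (Leibniz ⪯-identities): [a,b]·c + b·[a,c] = [a,bc] + (bac)°, and
a·[b,c] + [a,c]·b = [ab,c] + (acb)°; in particular [a,b]·c + b·[a,c] ⪰∘ [a,bc]
and a·[b,c] + [a,c]·b ⪰∘ [ab,c]. Here [x,y] = x·y + n(y·x) and z° = z + n(z). -/
theorem stmt10 {S : Type*} [Semiring S] (n : S → S)
    (hadd : ∀ x y : S, n (x + y) = n x + n y)
    (hinv : ∀ x : S, n (n x) = x)
    (hmull : ∀ x y : S, n (x * y) = n x * y)
    (hmulr : ∀ x y : S, n (x * y) = x * n y) :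
    ∀ a b c : S,
      ((a * b + n (b * a)) * c + b * (a * c + n (c * a))
          = (a * (b * c) + n ((b * c) * a)) + (b * a * c + n (b * a * c))) ∧
      (a * (b * c + n (c * b)) + (a * c + n (c * a)) * b
          = ((a * b) * c + n (c * (a * b))) + (a * c * b + n (a * c * b))) ∧
      (∃ z : S, (a * b + n (b * a)) * c + b * (a * c + n (c * a))
          = (a * (b * c) + n ((b * c) * a)) + (z + n z)) ∧
      (∃ z : S, a * (b * c + n (c * b)) + (a * c + n (c * a)) * b
          = ((a * b) * c + n (c * (a * b))) + (z + n z)) := by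
  intro a b c
  have left_leibniz : (a * b + n (b * a)) * c + b * (a * c + n (c * a))
      = (a * (b * c) + n ((b * c) * a)) + (b * a * c + n (b * a * c)) := by
    rw [add_mul, mul_add, ← hmull, ← hmulr]
    simp only [mul_assoc]
    abel
  have right_leibniz : a * (b * c + n (c * b)) + (a * c + n (c * a)) * b
      = ((a * b) * c + n (c * (a * b))) + (a * c * b + n (a * c * b)) := by
    rw [add_mul, mul_add, ← hmull, ← hmulr]
    simp only [mul_assoc]
    abel
  exact ⟨left_leibniz, right_leibniz, ⟨_, left_leibniz⟩, ⟨_, right_leibniz⟩⟩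
end

section
/- Such a hypergroup is canonical (reversible) if and only if hypernegation distributes over hyperaddition: the property (for all a,b,c ∈ T, a ∈ b ⊞ c if and only if b ∈ a ⊞ (−c)) holds if and only if for all a,b ∈ T the image of a ⊞ b under the map x ↦ −x equals (−a) ⊞ (−b). -/
/-- In a hypergroup, membership in a hypersum can be rotated cyclically. -/
theorem hypergroup_mem_rotate {T : Type*} {z : T} {hadd : T → T → Set T} {neg : T → T}
    (hcomm : ∀ a b : T, hadd a b = hadd b a)
    (hassoc : ∀ a b c : T,
      (⋃ x ∈ hadd a b, hadd x c) = ⋃ y ∈ hadd b c, hadd a y)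
    (hneg : ∀ a : T, z ∈ hadd a (neg a))
    (hneguniq : ∀ a b : T, z ∈ hadd a b → b = neg a) (a b c : T) :
    neg c ∈ hadd a b ↔ neg a ∈ hadd b c := by
  have h : z ∈ (⋃ x ∈ hadd a b, hadd x c) ↔ z ∈ ⋃ y ∈ hadd b c, hadd a y := by
    rw [hassoc]
  simp only [Set.mem_iUnion, exists_prop] at h
  constructor
  · intro hc
    obtain ⟨y, hy, hz⟩ := h.1 ⟨neg c, hc, hcomm c (neg c) ▸ hneg c⟩
    exact hneguniq a y hz ▸ hy
  · intro ha
    obtain ⟨x, hx, hz⟩ := h.2 ⟨neg a, ha, hneg a⟩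
    exact hneguniq c x (hcomm x c ▸ hz) ▸ hx

/-- Proposition 3.22: a hypergroup is canonical (reversible) if and only if
hypernegation distributes over hyperaddition. -/
theorem stmt11 {T : Type*} (z : T) (hadd : T → T → Set T) (neg : T → T)
    (hcomm : ∀ a b : T, hadd a b = hadd b a)
    (hneutral : ∀ a : T, hadd a z = {a})
    (hassoc : ∀ a b c : T,
      (⋃ x ∈ hadd a b, hadd x c) = ⋃ y ∈ hadd b c, hadd a y)
    (hneg : ∀ a : T, z ∈ hadd a (neg a))
    (hneguniq : ∀ a b : T, z ∈ hadd a b → b = neg a) :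
    (∀ a b c : T, a ∈ hadd b c ↔ b ∈ hadd a (neg c)) ↔
    (∀ a b : T, neg '' hadd a b = hadd (neg a) (neg b)) := by
  have hnn : Function.Involutive neg := fun a =>
    (hneguniq (neg a) a (hcomm a (neg a) ▸ hneg a)).symm
  have hrot (a b c : T) : a ∈ hadd b c ↔ neg b ∈ hadd c (neg a) := by
    rw [← hypergroup_mem_rotate hcomm hassoc hneg hneguniq, hnn]
  constructor
  · intro hrev a b
    ext x
    have hx : neg x ∈ hadd a b ↔ x ∈ hadd (neg a) (neg b) := by
      have h := hrot (neg x) a b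
      rw [hnn] at h
      rw [h, hrev x, hnn, hcomm b]
    constructor
    · rintro ⟨y, hy, rfl⟩
      exact hx.1 ((hnn y).symm ▸ hy)
    · exact fun h => ⟨neg x, hx.2 h, hnn x⟩
  · intro hdist a b c
    rw [hrot, ← hnn.injective.mem_set_image, hdist, hnn, hnn, hcomm]
end

section
/- Let (A,T,n) be a meta-tangible T-triple with unique quasi-negatives, and write T° = {a + n(a) : a ∈ T}. Then: if e' ∈ T then e' = 1; if e' ∈ T° then e' = e; and if e' ∉ T ∪ T° then n(1) = 1 (so that e' = 1+1+1). -/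
/-- Proposition 7.2: in a meta-tangible T-triple, either e' ∈ T and e' = 1, or
e' ∈ T° and e' = e, or e' ∉ T ∪ T° and then n(1) = 1 with e' = 1+1+1. -/
theorem stmt13 {A : Type*} [CommSemiring A] (n : A → A) (T : Set A)
    (hadd : ∀ x y : A, n (x + y) = n x + n y)
    (hinv : ∀ x : A, n (n x) = x)
    (hmul : ∀ x y : A, n (x * y) = n x * y)
    (hone : (1 : A) ∈ T)
    (hTmul : ∀ a ∈ T, ∀ b ∈ T, a * b ∈ T)
    (hTn : ∀ a ∈ T, n a ∈ T)
    (hdisj : ∀ a ∈ T, ¬ ∃ x : A, a = x + n x)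
    (hgen : ∀ c : A, c ≠ 0 → ∃ l : List A, (∀ x ∈ l, x ∈ T) ∧ l.sum = c)
    (huq : ∀ a ∈ T, ∀ b ∈ T, (∃ x : A, a + b = x + n x) → b = n a)
    (hmt : ∀ a ∈ T, ∀ b ∈ T, b ≠ n a → a + b ∈ T) :
    ((1 : A) + n 1 + 1 ∈ T → (1 : A) + n 1 + 1 = 1) ∧
    ((∃ a ∈ T, (1 : A) + n 1 + 1 = a + n a) → (1 : A) + n 1 + 1 = 1 + n 1) ∧
    (((1 : A) + n 1 + 1 ∉ T ∧ ¬ ∃ a ∈ T, (1 : A) + n 1 + 1 = a + n a) →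
      n 1 = 1 ∧ (1 : A) + n 1 + 1 = 1 + 1 + 1) := by
  have hm : ∀ x, n x = n 1 * x := fun x => by rw [← hmul, one_mul]
  have hcases : n 1 = 1 ∨ (1 : A) + n 1 + 1 ∈ T ∨ (1 : A) + n 1 + 1 = 1 + n 1 := by
    by_cases h1 : n 1 = 1
    · exact Or.inl h1
    · have h2 : (1 : A) + 1 ∈ T := hmt 1 hone 1 hone (Ne.symm h1)
      by_cases h : n 1 = n (1 + 1)
      · have h11 : (1 : A) = 1 + 1 := by simpa only [hinv] using congrArg n h
        right; right
        rw [add_right_comm, ← h11]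
      · right; left
        rw [add_right_comm]
        exact hmt _ h2 _ (hTn 1 hone) h
  refine ⟨fun h => ?_, ?_, ?_⟩
  · have h1 := huq _ h (n 1) (hTn 1 hone) ⟨1 + 1, by rw [hadd]; ring⟩
    rw [← hinv (1 + n 1 + 1), ← h1, hinv]
  · rintro ⟨a, ha, h⟩
    rcases hcases with h1 | hT | he
    · have hid : ∀ x, n x = x := fun x => by rw [hm, h1, one_mul]
      rw [hid, hid] at h
      rw [hid]
      by_cases ha1 : a = 1
      · rw [h, ha1]
      · have ha1T : a + 1 ∈ T := hmt a ha 1 hone (by rw [hid]; exact Ne.symm ha1)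
        have haa : a + 1 = a := by
          rw [← hid a]
          refine huq a ha (n a + 1) (by rwa [hid]) ⟨1 + 1, ?_⟩
          rw [hid, hid, ← add_assoc, ← h, ← add_assoc]
        refine absurd ⟨a * a, ?_⟩ (hdisj a ha)
        calc a = a + (1 + 1 + 1) := by rw [← add_assoc, ← add_assoc, haa, haa, haa]
          _ = a + (a + a) := by rw [h]
          _ = a * (1 + 1 + 1) := by ring
          _ = a * a + n (a * a) := by rw [h, hid, mul_add]
    · exact absurd ⟨a, h⟩ (hdisj _ hT)
    · exact he
  · rintro ⟨hT, hT0⟩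
    rcases hcases with h1 | h | h
    · exact ⟨h1, by rw [h1]⟩
    · exact absurd h hT
    · exact absurd ⟨1, hone, h⟩ hT0
end

section
/- Let (A,T,n) be a meta-tangible T-triple with unique quasi-negatives. Then for all a,b ∈ T, at least one of the following holds: (i) a = n(b); (ii) a + b = a; (iii) (a + n(a)) + b = b. -/
/-- Lemma 7.5: for a, b tangible in a meta-tangible T-triple, one of the
following holds: a = n(b), or a + b = a, or a° + b = b. -/
theorem stmt14 {A : Type*} [CommSemiring A] (n : A → A) (T : Set A)
    (hadd : ∀ x y : A, n (x + y) = n x + n y)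
    (hinv : ∀ x : A, n (n x) = x)
    (hmul : ∀ x y : A, n (x * y) = n x * y)
    (hone : (1 : A) ∈ T)
    (hTmul : ∀ a ∈ T, ∀ b ∈ T, a * b ∈ T)
    (hTn : ∀ a ∈ T, n a ∈ T)
    (hdisj : ∀ a ∈ T, ¬ ∃ x : A, a = x + n x)
    (hgen : ∀ c : A, c ≠ 0 → ∃ l : List A, (∀ x ∈ l, x ∈ T) ∧ l.sum = c)
    (huq : ∀ a ∈ T, ∀ b ∈ T, (∃ x : A, a + b = x + n x) → b = n a)
    (hmt : ∀ a ∈ T, ∀ b ∈ T, b ≠ n a → a + b ∈ T) :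
    ∀ a ∈ T, ∀ b ∈ T, a = n b ∨ a + b = a ∨ (a + n a) + b = b := by
  intro a ha b hb
  by_cases h : a = n b
  · exact Or.inl h
  by_cases hab : a + b = a
  · exact Or.inr (Or.inl hab)
  refine Or.inr (Or.inr ?_)
  have hsum : a + b ∈ T := by
    refine hmt a ha b hb fun e => h ?_
    rw [e, hinv]
  have hne : n a ≠ n (a + b) := fun e => hab <| by
    rw [← hinv (a + b), ← e, hinv]
  have hc : (a + n a) + b ∈ T := by
    rw [add_right_comm]
    exact hmt _ hsum _ (hTn a ha) hne
  have hq : n b = n ((a + n a) + b) := by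
    refine huq _ hc _ (hTn b hb) ⟨a + b, ?_⟩
    rw [hadd]
    abel
  rw [← hinv ((a + n a) + b), ← hq, hinv]
end

section
/- Let (A,T,n) be a meta-tangible T-triple with unique quasi-negatives, of the second kind (n(a) ≠ a for all a ∈ T). Then A = T ∪ A°: every element of A is either tangible or a quasi-zero. -/
/-- Lemma 7.9(i): in a meta-tangible T-triple of the second kind,
A = T ∪ A°: every element is tangible or a quasi-zero. -/
theorem stmt15 {A : Type*} [CommSemiring A] (n : A → A) (T : Set A)
    (hadd : ∀ x y : A, n (x + y) = n x + n y)
    (hinv : ∀ x : A, n (n x) = x)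
    (hmul : ∀ x y : A, n (x * y) = n x * y)
    (hone : (1 : A) ∈ T)
    (hTmul : ∀ a ∈ T, ∀ b ∈ T, a * b ∈ T)
    (hTn : ∀ a ∈ T, n a ∈ T)
    (hdisj : ∀ a ∈ T, ¬ ∃ x : A, a = x + n x)
    (hgen : ∀ c : A, c ≠ 0 → ∃ l : List A, (∀ x ∈ l, x ∈ T) ∧ l.sum = c)
    (huq : ∀ a ∈ T, ∀ b ∈ T, (∃ x : A, a + b = x + n x) → b = n a)
    (hmt : ∀ a ∈ T, ∀ b ∈ T, b ≠ n a → a + b ∈ T)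
    (hsk : ∀ a ∈ T, n a ≠ a) :
    ∀ c : A, c ∈ T ∨ ∃ x : A, c = x + n x := by
  have tangible_add : ∀ a ∈ T, ∀ b ∈ T, a + b ∈ T ∨ ∃ d ∈ T, a + b = d + n d := by
    intro a ha b hb
    by_cases h : b = n a
    · exact Or.inr ⟨a, ha, by rw [h]⟩
    · exact Or.inl (hmt a ha b hb h)
  have sum_mem : ∀ l : List A, (∀ x ∈ l, x ∈ T) →
      l.sum = 0 ∨ l.sum ∈ T ∨ ∃ b ∈ T, l.sum = b + n b := by
    intro l
    induction l with
    | nil => simp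
    | cons a l ih =>
      intro hl
      have ha : a ∈ T := hl a (by simp)
      rw [List.sum_cons]
      right
      rcases ih fun x hx => hl x (by simp [hx]) with h | h | ⟨b, hb, h⟩
      · exact Or.inl (by rwa [h, add_zero])
      · exact tangible_add a ha _ h
      · rw [h]
        by_cases hab : b = n a
        · have hne : n b ≠ n a := by
            rw [← hab]
            exact hsk b hb
          rw [add_comm b, ← add_assoc]
          exact tangible_add _ (hmt a ha _ (hTn b hb) hne) b hb
        · rw [← add_assoc]
          exact tangible_add _ (hmt a ha b hb hab) _ (hTn b hb)
  have n_zero : n 0 = 0 := by simpa using hmul 0 0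
  have zero_quasi : (0 : A) = 0 + n 0 := by rw [n_zero, add_zero]
  intro c
  by_cases hc : c = 0
  · exact Or.inr ⟨0, hc.trans zero_quasi⟩
  obtain ⟨l, hl, rfl⟩ := hgen c hc
  rcases sum_mem l hl with h | h | ⟨b, -, h⟩
  · exact absurd h hc
  · exact Or.inl h
  · exact Or.inr ⟨b, h⟩
end

section
/- Let (A,T,n) be a T-triple with unique quasi-negatives (not assumed meta-tangible), and write T° = {a + n(a) : a ∈ T}. The following are equivalent: (i) every element of A lies in T ∪ T° ∪ {0}; (ii) (A,T,n) is meta-tangible and every element of A is 0, an element of T, or a sum of two elements of T (height at most 2); (iii) (A,T,n) is meta-tangible and e' = 1 or e' = e. -/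
/-- If `e' = 1 + n 1 + 1` is `0`, tangible, or of the form `a + n a` with `a` tangible, in a
meta-tangible triple with unique quasi-negatives, then `e'` is `1` or `e = 1 + n 1`. -/
theorem ePrime_eq_one_or_eq_e {A : Type*} [CommSemiring A] {n : A → A} {T : Set A}
    (hadd : ∀ x y : A, n (x + y) = n x + n y)
    (hinv : ∀ x : A, n (n x) = x)
    (hmul : ∀ x y : A, n (x * y) = n x * y)
    (hone : (1 : A) ∈ T)
    (hTn : ∀ a ∈ T, n a ∈ T)
    (hdisj : ∀ a ∈ T, ¬ ∃ x : A, a = x + n x)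
    (huq : ∀ a ∈ T, ∀ b ∈ T, (∃ x : A, a + b = x + n x) → b = n a)
    (hmeta : ∀ a ∈ T, ∀ b ∈ T, b ≠ n a → a + b ∈ T)
    (h : (1 : A) + n 1 + 1 = 0 ∨ (1 : A) + n 1 + 1 ∈ T ∨ ∃ a ∈ T, (1 : A) + n 1 + 1 = a + n a) :
    (1 : A) + n 1 + 1 = 1 ∨ (1 : A) + n 1 + 1 = 1 + n 1 := by
  have hn0 : n 0 = 0 := by simpa using hmul 0 0
  have hne : n (1 + n 1) = 1 + n 1 := by rw [hadd, hinv, add_comm]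
  have hdouble : (1 : A) + n 1 + 1 + n 1 = (1 + n 1) + n (1 + n 1) := by
    rw [hne, add_assoc]
  rcases h with h0 | hT | ⟨a, ha, h⟩
  · by_cases h1 : (1 : A) = n 1
    · have h3 : (1 : A) + 1 + 1 = 0 := by rwa [← h1] at h0
      refine absurd ⟨1 + 1, ?_⟩ (hdisj 1 hone)
      rw [hadd, ← h1, ← add_assoc, h3, zero_add]
    · have h2 : (1 : A) + 1 ∈ T := hmeta 1 hone 1 hone h1
      have h3 : n 1 = n (1 + 1) :=
        huq _ h2 _ (hTn 1 hone) ⟨0, by rw [add_right_comm, h0, hn0, add_zero]⟩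
      right
      rw [hadd] at h3
      rw [add_right_comm, ← hinv (1 + 1), hadd, ← h3, hinv]
  · left
    have h1 : n 1 = n (1 + n 1 + 1) := huq _ hT _ (hTn 1 hone) ⟨_, hdouble⟩
    rw [← hinv (1 + n 1 + 1), ← h1, hinv]
  · by_cases ha1 : a = 1
    · right; rw [h, ha1]
    by_cases han : a = n 1
    · right; rw [h, han, hinv, add_comm]
    exfalso
    have hp : a + 1 ∈ T := hmeta a ha 1 hone fun h1 => han (by rw [h1, hinv])
    have hm : a + n 1 ∈ T := hmeta a ha _ (hTn 1 hone) fun h1 =>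
      ha1 (by rw [← hinv a, ← h1, hinv])
    have hsum : a + n a + n 1 = (1 + n 1) + n (1 + n 1) := by rw [← h, hdouble]
    have hsum' : a + n a + 1 = (1 + n 1) + n (1 + n 1) := by
      have := congrArg n hsum
      simp only [hadd, hinv] at this ⊢
      rw [add_comm a, this]
      ac_rfl
    have ha' : a + 1 = a := by
      have h1 := huq a ha _ (hTn _ hp) ⟨1 + n 1, by rw [hadd a, ← add_assoc, hsum]⟩
      rw [← hinv (a + 1), h1, hinv]
    have ha'' : a + n 1 = a := by
      have h1 := huq a ha _ (hTn _ hm) ⟨1 + n 1, by rw [hadd a, hinv, ← add_assoc, hsum']⟩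
      rw [← hinv (a + n 1), h1, hinv]
    refine hdisj a ha ⟨a * a, ?_⟩
    calc a = a + 1 + n 1 + 1 := by rw [ha', ha'', ha']
      _ = a + n a + a := by rw [← h]; ac_rfl
      _ = (1 + n 1 + 1) * a := by rw [add_mul, add_mul, ← hmul, one_mul]
      _ = a * a + n (a * a) := by rw [h, add_mul, hmul]

/-- In a meta-tangible triple with `e' = 1` or `e' = e`, every sum of tangible elements is `0`,
tangible, or of the form `a + n a` with `a` tangible. -/
theorem list_sum_eq_zero_or_mem_or_eq_add_neg {A : Type*} [CommSemiring A] {n : A → A} {T : Set A}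
    (hinv : ∀ x : A, n (n x) = x)
    (hmul : ∀ x y : A, n (x * y) = n x * y)
    (hTn : ∀ a ∈ T, n a ∈ T)
    (hmeta : ∀ a ∈ T, ∀ b ∈ T, b ≠ n a → a + b ∈ T)
    (he : (1 : A) + n 1 + 1 = 1 ∨ (1 : A) + n 1 + 1 = 1 + n 1)
    (l : List A) (hl : ∀ x ∈ l, x ∈ T) :
    l.sum = 0 ∨ l.sum ∈ T ∨ ∃ a ∈ T, l.sum = a + n a := by
  have hself : ∀ a ∈ T, a + n a + a ∈ T ∨ a + n a + a = a + n a := by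
    intro a ha
    have key : a + n a + a = (1 + n 1 + 1) * a := by rw [add_mul, add_mul, ← hmul, one_mul]
    rcases he with he | he
    · left; rwa [key, he, one_mul]
    · right; rw [key, he, add_mul, ← hmul, one_mul]
  induction l with
  | nil => simp
  | cons t l ih =>
    have ht : t ∈ T := hl t (by simp)
    rw [List.sum_cons]
    right
    rcases ih fun x hx => hl x (List.mem_cons_of_mem _ hx) with h | h | ⟨a, ha, h⟩
    · left; rwa [h, add_zero]
    · by_cases hn : l.sum = n t
      · exact Or.inr ⟨t, ht, by rw [hn]⟩
      · exact Or.inl (hmeta t ht _ h hn)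
    · rw [h]
      by_cases hta : t = n a
      · have hs := hself t ht
        have hat : a = n t := by rw [hta, hinv]
        have heq : t + (a + n a) = t + n t + t := by rw [← hta, hat, add_assoc]
        rw [heq]
        exact hs.imp id fun hs => ⟨t, ht, hs⟩
      · have hat : a + t ∈ T := hmeta a ha t ht hta
        by_cases hc : a + t = a
        · exact Or.inr ⟨a, ha, by rw [← add_assoc, add_comm t, hc]⟩
        · left
          have := hmeta (n a) (hTn a ha) _ hat (by rwa [hinv])
          rwa [show t + (a + n a) = n a + (a + t) by ac_rfl]


/-- Proposition 7.18: for a T-triple with unique quasi-negatives, the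
following are equivalent: (i) A = T ∪ T° ∪ {0}; (ii) A is meta-tangible of
height ≤ 2; (iii) A is meta-tangible with e' ∈ {1, e}. -/
theorem stmt16 {A : Type*} [CommSemiring A] (n : A → A) (T : Set A)
    (hadd : ∀ x y : A, n (x + y) = n x + n y)
    (hinv : ∀ x : A, n (n x) = x)
    (hmul : ∀ x y : A, n (x * y) = n x * y)
    (hone : (1 : A) ∈ T)
    (hTmul : ∀ a ∈ T, ∀ b ∈ T, a * b ∈ T)
    (hTn : ∀ a ∈ T, n a ∈ T)
    (hdisj : ∀ a ∈ T, ¬ ∃ x : A, a = x + n x)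
    (hgen : ∀ c : A, c ≠ 0 → ∃ l : List A, (∀ x ∈ l, x ∈ T) ∧ l.sum = c)
    (huq : ∀ a ∈ T, ∀ b ∈ T, (∃ x : A, a + b = x + n x) → b = n a) :
    ((∀ c : A, c = 0 ∨ c ∈ T ∨ ∃ a ∈ T, c = a + n a) ↔
      ((∀ a ∈ T, ∀ b ∈ T, b ≠ n a → a + b ∈ T) ∧
        ∀ c : A, c = 0 ∨ c ∈ T ∨ ∃ a ∈ T, ∃ b ∈ T, c = a + b)) ∧
    (((∀ a ∈ T, ∀ b ∈ T, b ≠ n a → a + b ∈ T) ∧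
        ∀ c : A, c = 0 ∨ c ∈ T ∨ ∃ a ∈ T, ∃ b ∈ T, c = a + b) ↔
      ((∀ a ∈ T, ∀ b ∈ T, b ≠ n a → a + b ∈ T) ∧
        ((1 : A) + n 1 + 1 = 1 ∨ (1 : A) + n 1 + 1 = 1 + n 1))) := by
  have hn0 : n 0 = 0 := by simpa using hmul 0 0
  have h12 : (∀ c : A, c = 0 ∨ c ∈ T ∨ ∃ a ∈ T, c = a + n a) ↔
      ((∀ a ∈ T, ∀ b ∈ T, b ≠ n a → a + b ∈ T) ∧
        ∀ c : A, c = 0 ∨ c ∈ T ∨ ∃ a ∈ T, ∃ b ∈ T, c = a + b) := by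
    constructor
    · refine fun h => ⟨fun a ha b hb hab => ?_, fun c => ?_⟩
      · rcases h (a + b) with h0 | hT | ⟨x, -, hx⟩
        · exact absurd (huq a ha b hb ⟨0, by rw [h0, hn0, add_zero]⟩) hab
        · exact hT
        · exact absurd (huq a ha b hb ⟨x, hx⟩) hab
      · exact (h c).imp id (Or.imp id fun ⟨a, ha, hc⟩ => ⟨a, ha, n a, hTn a ha, hc⟩)
    · rintro ⟨hmeta, h⟩ c
      rcases h c with h0 | hT | ⟨a, ha, b, hb, rfl⟩
      · exact Or.inl h0
      · exact Or.inr (Or.inl hT)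
      · by_cases hab : b = n a
        · exact Or.inr (Or.inr ⟨a, ha, by rw [hab]⟩)
        · exact Or.inr (Or.inl (hmeta a ha b hb hab))
  refine ⟨h12, fun h => ⟨h.1, ?_⟩, fun ⟨hmeta, he⟩ => h12.1 fun c => ?_⟩
  · exact ePrime_eq_one_or_eq_e hadd hinv hmul hone hTn hdisj huq h.1 (h12.2 h _)
  · by_cases hc : c = 0
    · exact Or.inl hc
    · obtain ⟨l, hl, rfl⟩ := hgen c hc
      exact list_sum_eq_zero_or_mem_or_eq_add_neg hinv hmul hTn hmeta he l hl
end

section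
/- Let (A,T,n) be a meta-tangible T-triple with unique quasi-negatives such that T is a group under multiplication. Then the fuzzy property holds: for all a₁,a₁',a₂,a₂' ∈ A, if a₁ + n(a₁') ∈ A° and a₂ + n(a₂') ∈ A°, then a₁·a₂ + n(a₁'·a₂') ∈ A°. -/
/-- `c` is a quasi-zero for the negation map `n`. -/
def IsQuasiZero {A : Type*} [Add A] (n : A → A) (c : A) : Prop := ∃ x : A, c = x + n x

section NegationMap

variable {A : Type*} [CommSemiring A] {n : A → A}

theorem IsQuasiZero.add (hadd : ∀ x y : A, n (x + y) = n x + n y) {c d : A}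
    (hc : IsQuasiZero n c) (hd : IsQuasiZero n d) : IsQuasiZero n (c + d) := by
  obtain ⟨x, rfl⟩ := hc
  obtain ⟨y, rfl⟩ := hd
  exact ⟨x + y, by rw [hadd]; ring⟩

theorem IsQuasiZero.mul_right (hmul : ∀ x y : A, n (x * y) = n x * y) {c : A}
    (hc : IsQuasiZero n c) (d : A) : IsQuasiZero n (c * d) := by
  obtain ⟨x, rfl⟩ := hc
  exact ⟨x * d, by rw [hmul]; ring⟩

theorem IsQuasiZero.mul_left (hmul : ∀ x y : A, n (x * y) = n x * y) {c : A}
    (hc : IsQuasiZero n c) (d : A) : IsQuasiZero n (d * c) :=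
  mul_comm c d ▸ hc.mul_right hmul d

theorem IsQuasiZero.neg_eq (hadd : ∀ x y : A, n (x + y) = n x + n y)
    (hinv : ∀ x : A, n (n x) = x) {c : A} (hc : IsQuasiZero n c) : n c = c := by
  obtain ⟨x, rfl⟩ := hc
  rw [hadd, hinv, add_comm]

theorem neg_zero_of_neg_mul (hmul : ∀ x y : A, n (x * y) = n x * y) : n 0 = 0 := by
  simpa using hmul 0 0

theorem isQuasiZero_zero (hmul : ∀ x y : A, n (x * y) = n x * y) : IsQuasiZero n (0 : A) :=
  ⟨0, by rw [neg_zero_of_neg_mul hmul, add_zero]⟩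

/-- Both elements are quasi-zeros, or one of them is a quasi-zero absorbing the other. -/
def QuasiZeroAbsorbs (n : A → A) (x y : A) : Prop :=
  (IsQuasiZero n x ∧ IsQuasiZero n y) ∨ (IsQuasiZero n y ∧ x + y = y) ∨
    (IsQuasiZero n x ∧ x + y = x)

theorem QuasiZeroAbsorbs.symm {x y : A} (h : QuasiZeroAbsorbs n x y) :
    QuasiZeroAbsorbs n y x := by
  rcases h with ⟨h, h'⟩ | ⟨h, h'⟩ | ⟨h, h'⟩
  · exact .inl ⟨h', h⟩
  · exact .inr (.inr ⟨h, by rwa [add_comm]⟩)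
  · exact .inr (.inl ⟨h, by rwa [add_comm]⟩)

theorem isQuasiZero_add_neg_of_both (hadd : ∀ x y : A, n (x + y) = n x + n y)
    (hinv : ∀ x : A, n (n x) = x) {c d : A}
    (hc : IsQuasiZero n c) (hd : IsQuasiZero n d) : IsQuasiZero n (c + n d) := by
  rw [hd.neg_eq hadd hinv]
  exact hc.add hadd hd

theorem isQuasiZero_add_neg_comm (hadd : ∀ x y : A, n (x + y) = n x + n y)
    (hinv : ∀ x : A, n (n x) = x) {c d : A}
    (h : IsQuasiZero n (c + n d)) : IsQuasiZero n (d + n c) := by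
  have := h.neg_eq hadd hinv
  rw [hadd, hinv] at this
  rwa [add_comm, this]

theorem mul_add_mul_eq_of_absorbs {x₁ y₁ x₂ y₂ : A} (h₁ : x₁ + y₁ = y₁) (h₂ : x₂ + y₂ = y₂) :
    x₁ * x₂ + y₁ * y₂ = y₁ * y₂ := by
  calc x₁ * x₂ + y₁ * y₂ = x₁ * x₂ + (x₁ + y₁) * y₂ := by rw [h₁]
    _ = x₁ * (x₂ + y₂) + y₁ * y₂ := by ring
    _ = (x₁ + y₁) * y₂ := by rw [h₂]; ring
    _ = y₁ * y₂ := by rw [h₁]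

theorem QuasiZeroAbsorbs.mul (hadd : ∀ x y : A, n (x + y) = n x + n y)
    (hinv : ∀ x : A, n (n x) = x) (hmul : ∀ x y : A, n (x * y) = n x * y) {x₁ y₁ x₂ y₂ : A}
    (h₁ : QuasiZeroAbsorbs n x₁ y₁) (h₂ : QuasiZeroAbsorbs n x₂ y₂) :
    IsQuasiZero n (x₁ * x₂ + n (y₁ * y₂)) := by
  have both {c d : A} := isQuasiZero_add_neg_of_both hadd hinv (c := c) (d := d)
  rcases h₁ with ⟨hx, hy⟩ | ⟨hy, e₁⟩ | ⟨hx, e₁⟩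
  · exact both (hx.mul_right hmul _) (hy.mul_right hmul _)
  · rcases h₂ with ⟨hx', hy'⟩ | ⟨hy', e₂⟩ | ⟨hx', e₂⟩
    · exact both (hx'.mul_left hmul _) (hy'.mul_left hmul _)
    · have q := hy.mul_right hmul y₂
      rw [q.neg_eq hadd hinv, mul_add_mul_eq_of_absorbs e₁ e₂]
      exact q
    · exact both (hx'.mul_left hmul _) (hy.mul_right hmul _)
  · rcases h₂ with ⟨hx', hy'⟩ | ⟨hy', e₂⟩ | ⟨hx', e₂⟩
    · exact both (hx'.mul_left hmul _) (hy'.mul_left hmul _)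
    · exact both (hx.mul_right hmul _) (hy'.mul_left hmul _)
    · apply isQuasiZero_add_neg_comm hadd hinv
      have q := hx.mul_right hmul x₂
      rw [add_comm] at e₁ e₂
      rw [q.neg_eq hadd hinv, mul_add_mul_eq_of_absorbs e₁ e₂]
      exact q

theorem natCast_mul_add_of_absorbs {x y : A} (h : x + y = y) (k : ℕ) :
    (k : A) * x + y = y := by
  induction k with
  | zero => simp
  | succ k ih => rw [Nat.cast_succ, add_mul, one_mul, add_assoc, h, ih]

theorem natCast_mul_add_natCast_mul_of_absorbs {x y : A} (h : x + y = y) (k : ℕ) {l : ℕ}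
    (hl : l ≠ 0) : (k : A) * x + l * y = l * y := by
  obtain ⟨m, rfl⟩ := Nat.exists_eq_succ_of_ne_zero hl
  calc (k : A) * x + (m.succ : ℕ) * y = ((k : A) * x + y) + m * y := by push_cast; ring
    _ = (m.succ : ℕ) * y := by rw [natCast_mul_add_of_absorbs h]; push_cast; ring

theorem isQuasiZero_of_absorbed_mul_multiple (hadd : ∀ x y : A, n (x + y) = n x + n y)
    (hinv : ∀ x : A, n (n x) = x) (hmul : ∀ x y : A, n (x * y) = n x * y) {x y a : A} {k l : ℕ}
    (hy : IsQuasiZero n y) (e : x + y = y) (h : IsQuasiZero n ((k : A) * a + n (l * a))) :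
    IsQuasiZero n (x * (k * a) + n (y * (l * a))) := by
  have q := hy.mul_right hmul (l * a)
  rcases eq_or_ne l 0 with rfl | hl
  · refine isQuasiZero_add_neg_of_both hadd hinv (.mul_left hmul ?_ _) q
    simpa [neg_zero_of_neg_mul hmul] using h
  · rw [q.neg_eq hadd hinv]
    have := natCast_mul_add_natCast_mul_of_absorbs e k hl
    have e' : x * (k * a) + y * (l * a) = y * (l * a) := by
      calc x * (k * a) + y * (l * a) = a * (k * x + l * y) := by ring
        _ = y * (l * a) := by rw [this]; ring
    rwa [e']

theorem QuasiZeroAbsorbs.mul_multiple (hadd : ∀ x y : A, n (x + y) = n x + n y)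
    (hinv : ∀ x : A, n (n x) = x) (hmul : ∀ x y : A, n (x * y) = n x * y) {x y a : A} {k l : ℕ}
    (h₁ : QuasiZeroAbsorbs n x y) (h : IsQuasiZero n ((k : A) * a + n (l * a))) :
    IsQuasiZero n (x * (k * a) + n (y * (l * a))) := by
  rcases h₁ with ⟨hx, hy⟩ | ⟨hy, e⟩ | ⟨hx, e⟩
  · exact isQuasiZero_add_neg_of_both hadd hinv (hx.mul_right hmul _) (hy.mul_right hmul _)
  · exact isQuasiZero_of_absorbed_mul_multiple hadd hinv hmul hy e h
  · apply isQuasiZero_add_neg_comm hadd hinv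
    exact isQuasiZero_of_absorbed_mul_multiple hadd hinv hmul hx (by rwa [add_comm])
      (isQuasiZero_add_neg_comm hadd hinv h)

end NegationMap

theorem mul_add_mul_mem_of_odd {S : Set ℕ} (hS : ∀ m ∈ S, ∀ j, m + 2 * j ∈ S) {k₁ l₁ k₂ l₂ : ℕ}
    (h₁ : k₁ + l₁ ∈ S) (h₂ : k₂ + l₂ ∈ S) (hk₁ : Odd k₁) (hk₂ : Odd k₂) (hl₁ : Even l₁) :
    k₁ * k₂ + l₁ * l₂ ∈ S := by
  have up : ∀ m ∈ S, Odd m → ∀ m', Odd m' → m ≤ m' → m' ∈ S := by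
    intro m hm ⟨i, hi⟩ m' ⟨j, hj⟩ hle
    convert hS m hm (j - i) using 1
    omega
  have hodd : Odd (k₁ * k₂ + l₁ * l₂) := (hk₁.mul hk₂).add_even (hl₁.mul_right l₂)
  rcases Nat.eq_zero_or_pos l₂ with rfl | hl₂
  · exact up k₂ h₂ hk₂ _ hodd (by nlinarith [hk₁.pos])
  · exact up _ h₁ (hk₁.add_even hl₁) _ hodd (by nlinarith [hk₂.pos])

theorem mul_add_mul_mem_of_even_mem {S : Set ℕ} (h0 : 0 ∈ S) (hS : ∀ m ∈ S, ∀ j, m + 2 * j ∈ S)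
    {k₁ l₁ k₂ l₂ : ℕ} (h₁ : k₁ + l₁ ∈ S) (h₂ : k₂ + l₂ ∈ S) : k₁ * k₂ + l₁ * l₂ ∈ S := by
  have main : ∀ {k₁ l₁ k₂ l₂ : ℕ}, k₁ + l₁ ∈ S → k₂ + l₂ ∈ S → Odd (k₁ * k₂) → Even (l₁ * l₂) →
      k₁ * k₂ + l₁ * l₂ ∈ S := by
    intro k₁ l₁ k₂ l₂ h₁ h₂ hk hl
    obtain ⟨hk₁, hk₂⟩ := Nat.odd_mul.1 hk
    rcases Nat.even_mul.1 hl with hl | hl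
    · exact mul_add_mul_mem_of_odd hS h₁ h₂ hk₁ hk₂ hl
    · rw [mul_comm k₁, mul_comm l₁]
      exact mul_add_mul_mem_of_odd hS h₂ h₁ hk₂ hk₁ hl
  rcases Nat.even_or_odd (k₁ * k₂ + l₁ * l₂) with ⟨j, hj⟩ | ho
  · rw [hj, ← two_mul, ← zero_add (2 * j)]
    exact hS 0 h0 j
  · rcases Nat.even_or_odd (k₁ * k₂) with hk | hk
    · rw [add_comm k₁] at h₁
      rw [add_comm k₂] at h₂
      rw [add_comm] at ho ⊢
      exact main h₁ h₂ ((Nat.odd_add.1 ho).2 hk) hk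
    · exact main h₁ h₂ hk ((Nat.odd_add.1 ho).1 hk)

section MetaTangible

variable {A : Type*} [CommSemiring A] {n : A → A} {T : Set A}

theorem add_eq_left_or_add_neg_add_eq (hadd : ∀ x y : A, n (x + y) = n x + n y)
    (hinv : ∀ x : A, n (n x) = x) (hTn : ∀ a ∈ T, n a ∈ T)
    (huq : ∀ a ∈ T, ∀ b ∈ T, IsQuasiZero n (a + b) → b = n a)
    (hmt : ∀ a ∈ T, ∀ b ∈ T, b ≠ n a → a + b ∈ T) {a b : A} (ha : a ∈ T) (hb : b ∈ T)
    (hab : b ≠ n a) : a + b = a ∨ a + n a + b = b := by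
  have hs := hmt a ha b hb hab
  by_cases h : n a = n (a + b)
  · exact .inl (by rw [← hinv (a + b), ← h, hinv])
  · have ht := hmt _ hs _ (hTn a ha) h
    have e := congrArg n (huq _ ht _ (hTn b hb) ⟨a + b, by rw [hadd]; ring⟩)
    rw [hinv, hinv] at e
    exact .inr (by rw [add_right_comm, ← e])

theorem exists_natCast_mul_of_neg_eq_self (hone : (1 : A) ∈ T)
    (hn : ∀ x, n x = x)
    (hgen : ∀ c : A, c ≠ 0 → ∃ l : List A, (∀ x ∈ l, x ∈ T) ∧ l.sum = c)
    (hmt : ∀ a ∈ T, ∀ b ∈ T, b ≠ n a → a + b ∈ T)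
    (key : ∀ {a b : A}, a ∈ T → b ∈ T → b ≠ n a → a + b = a ∨ a + n a + b = b) (c : A) :
    ∃ (k : ℕ), ∃ a ∈ T, c = k * a := by
  have aux : ∀ l : List A, (∀ x ∈ l, x ∈ T) → ∃ (k : ℕ), ∃ a ∈ T, l.sum = k * a := by
    intro l hl
    induction l with
    | nil => exact ⟨0, 1, hone, by simp⟩
    | cons b l ih =>
      obtain ⟨k, a, ha, e⟩ := ih fun x hx => hl x (List.mem_cons_of_mem _ hx)
      have hb : b ∈ T := hl b List.mem_cons_self
      rw [List.sum_cons, e]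
      by_cases hab : b = a
      · exact ⟨k + 1, a, ha, by rw [hab]; push_cast; ring⟩
      rcases Nat.eq_zero_or_pos k with rfl | hk
      · exact ⟨1, b, hb, by simp⟩
      have hab' : b ≠ n a := by rwa [hn]
      rcases key ha hb hab' with h | h
      · have := natCast_mul_add_natCast_mul_of_absorbs (x := b) (y := a) (by rwa [add_comm]) 1
          hk.ne'
        exact ⟨k, a, ha, by simpa using this⟩
      · rw [hn] at h
        rcases Nat.even_or_odd' k with ⟨j, rfl | rfl⟩
        · refine ⟨1, b, hb, ?_⟩
          calc b + ((2 * j : ℕ) : A) * a = j * (a + a) + b := by push_cast; ring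
            _ = (1 : ℕ) * b := by rw [natCast_mul_add_of_absorbs h]; simp
        · refine ⟨1, a + b, hmt a ha b hb hab', ?_⟩
          calc b + ((2 * j + 1 : ℕ) : A) * a = a + (j * (a + a) + b) := by push_cast; ring
            _ = (1 : ℕ) * (a + b) := by rw [natCast_mul_add_of_absorbs h]; simp
  by_cases hc : c = 0
  · exact ⟨0, 1, hone, by simp [hc]⟩
  · obtain ⟨l, hl, rfl⟩ := hgen c hc
    exact aux l hl

theorem multiples_or_absorbs_of_neg_eq_self
    (hn : ∀ x, n x = x) (hmul : ∀ x y : A, n (x * y) = n x * y)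
    (hdisj : ∀ a ∈ T, ¬ IsQuasiZero n a)
    (hmt : ∀ a ∈ T, ∀ b ∈ T, b ≠ n a → a + b ∈ T)
    (key : ∀ {a b : A}, a ∈ T → b ∈ T → b ≠ n a → a + b = a ∨ a + n a + b = b)
    {a b : A} (ha : a ∈ T) (hb : b ∈ T) (k l : ℕ) (h : IsQuasiZero n (k * a + n (l * b))) :
    a = b ∨ QuasiZeroAbsorbs n (k * a) (l * b) := by
  by_cases hab : a = b
  · exact .inl hab
  refine .inr ?_
  rw [hn] at h
  rcases eq_or_ne k 0 with rfl | hk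
  · exact .inl ⟨by simpa using isQuasiZero_zero hmul, by simpa using h⟩
  rcases eq_or_ne l 0 with rfl | hl
  · exact .inl ⟨by simpa using h, by simpa using isQuasiZero_zero hmul⟩
  have hba : b ≠ n a := by rw [hn]; exact Ne.symm hab
  have hab' : a ≠ n b := by rwa [hn]
  have even_mul : ∀ (j : ℕ) (c : A), IsQuasiZero n ((2 * j : ℕ) * c) := fun j c =>
    ⟨j * c, by rw [hn]; push_cast; ring⟩
  rcases key ha hb hba with h₁ | h₁
  · have := natCast_mul_add_natCast_mul_of_absorbs (x := b) (y := a) (by rwa [add_comm]) l hk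
    rw [add_comm] at this
    exact .inr (.inr ⟨this ▸ h, this⟩)
  rcases key hb ha hab' with h₂ | h₂
  · have := natCast_mul_add_natCast_mul_of_absorbs (x := a) (y := b) (by rwa [add_comm]) k hl
    exact .inr (.inl ⟨this ▸ h, this⟩)
  rw [hn] at h₁ h₂
  have h₁' : b + b + b = b := by
    calc b + b + b = (a + a + b) + (b + b) := by rw [h₁, add_comm]
      _ = (b + b + a) + (a + b) := by ring
      _ = b := by rw [h₂, ← add_assoc, h₁]
  have h₂' : a + a + a = a := by
    calc a + a + a = (b + b + a) + (a + a) := by rw [h₂, add_comm]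
      _ = (a + a + b) + (b + a) := by ring
      _ = a := by rw [h₁, ← add_assoc, h₂]
  rcases Nat.even_or_odd' k with ⟨i, rfl | rfl⟩ <;> rcases Nat.even_or_odd' l with ⟨j, rfl | rfl⟩
  · exact .inl ⟨even_mul _ _, even_mul _ _⟩
  · have e : ((2 * i : ℕ) : A) * a + (2 * j + 1 : ℕ) * b = b := by
      calc _ = (i : A) * (a + a) + (j * (b + b) + b) := by push_cast; ring
        _ = b := by rw [natCast_mul_add_of_absorbs h₁', natCast_mul_add_of_absorbs h₁]
    rw [e] at h
    exact absurd h (hdisj b hb)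
  · have e : ((2 * i + 1 : ℕ) : A) * a + (2 * j : ℕ) * b = a := by
      calc _ = (j : A) * (b + b) + (i * (a + a) + a) := by push_cast; ring
        _ = a := by rw [natCast_mul_add_of_absorbs h₂', natCast_mul_add_of_absorbs h₂]
    rw [e] at h
    exact absurd h (hdisj a ha)
  · have e : ((2 * i + 1 : ℕ) : A) * a + (2 * j + 1 : ℕ) * b = a + b := by
      calc _ = ((j : A) * (b + b) + a) + (i * (a + a) + b) := by push_cast; ring
        _ = a + b := by rw [natCast_mul_add_of_absorbs h₂, natCast_mul_add_of_absorbs h₁]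
    rw [e] at h
    exact absurd h (hdisj _ (hmt a ha b hb hba))

theorem eq_zero_or_mem_or_eq_add_neg
    (hgen : ∀ c : A, c ≠ 0 → ∃ l : List A, (∀ x ∈ l, x ∈ T) ∧ l.sum = c)
    (hmt : ∀ a ∈ T, ∀ b ∈ T, b ≠ n a → a + b ∈ T)
    (absorb : ∀ {a b : A}, a ∈ T → b ∈ T → a + n a + b = a + n a ∨ a + n a + b = b) (c : A) :
    c = 0 ∨ c ∈ T ∨ ∃ a ∈ T, c = a + n a := by
  have aux : ∀ l : List A, (∀ x ∈ l, x ∈ T) →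
      l.sum = 0 ∨ l.sum ∈ T ∨ ∃ a ∈ T, l.sum = a + n a := by
    intro l hl
    induction l with
    | nil => simp
    | cons b l ih =>
      have hb : b ∈ T := hl b List.mem_cons_self
      rw [List.sum_cons, add_comm]
      right
      rcases ih fun x hx => hl x (List.mem_cons_of_mem _ hx) with e | h | ⟨a, ha, e⟩
      · exact .inl (by rwa [e, zero_add])
      · by_cases hab : b = n l.sum
        · exact .inr ⟨l.sum, h, by rw [← hab]⟩
        · exact .inl (hmt _ h _ hb hab)
      · rw [e]
        rcases absorb ha hb with h | h
        · exact .inr ⟨a, ha, h⟩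
        · exact .inl (by rwa [h])
  by_cases hc : c = 0
  · exact .inl hc
  · obtain ⟨l, hl, rfl⟩ := hgen c hc
    exact aux l hl

end MetaTangible

/-- Theorem 7.38: meta-tangible T-triples (with T a group) satisfy the fuzzy
property: a₁ + n(a₁') ∈ A° and a₂ + n(a₂') ∈ A° imply a₁a₂ + n(a₁'a₂') ∈ A°. -/
theorem stmt17 {A : Type*} [CommSemiring A] (n : A → A) (T : Set A)
    (hadd : ∀ x y : A, n (x + y) = n x + n y)
    (hinv : ∀ x : A, n (n x) = x)
    (hmul : ∀ x y : A, n (x * y) = n x * y)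
    (hone : (1 : A) ∈ T)
    (hTmul : ∀ a ∈ T, ∀ b ∈ T, a * b ∈ T)
    (hTn : ∀ a ∈ T, n a ∈ T)
    (hdisj : ∀ a ∈ T, ¬ ∃ x : A, a = x + n x)
    (hgen : ∀ c : A, c ≠ 0 → ∃ l : List A, (∀ x ∈ l, x ∈ T) ∧ l.sum = c)
    (huq : ∀ a ∈ T, ∀ b ∈ T, (∃ x : A, a + b = x + n x) → b = n a)
    (hmt : ∀ a ∈ T, ∀ b ∈ T, b ≠ n a → a + b ∈ T)
    (hgrp : ∀ t ∈ T, ∃ s ∈ T, t * s = 1) :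
    ∀ a₁ a₁' a₂ a₂' : A,
      (∃ x : A, a₁ + n a₁' = x + n x) →
      (∃ x : A, a₂ + n a₂' = x + n x) →
      ∃ x : A, a₁ * a₂ + n (a₁' * a₂') = x + n x := by
  have huq' : ∀ a ∈ T, ∀ b ∈ T, IsQuasiZero n (a + b) → b = n a := huq
  have hdisj' : ∀ a ∈ T, ¬ IsQuasiZero n a := hdisj
  have key {a b : A} (ha : a ∈ T) (hb : b ∈ T) (hab : b ≠ n a) :=
    add_eq_left_or_add_neg_add_eq hadd hinv hTn huq' hmt ha hb hab
  intro x₁ y₁ x₂ y₂ h₁ h₂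
  by_cases hn1 : n 1 = 1
  · have hn : ∀ x, n x = x := fun x => by simpa [hn1] using hmul 1 x
    have cls := exists_natCast_mul_of_neg_eq_self hone hn hgen hmt key
    obtain ⟨k₁, a₁, ha₁, rfl⟩ := cls x₁
    obtain ⟨l₁, b₁, hb₁, rfl⟩ := cls y₁
    obtain ⟨k₂, a₂, ha₂, rfl⟩ := cls x₂
    obtain ⟨l₂, b₂, hb₂, rfl⟩ := cls y₂
    rcases multiples_or_absorbs_of_neg_eq_self hn hmul hdisj' hmt key ha₁ hb₁ k₁ l₁ h₁ with
      rfl | p₁ <;>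
    rcases multiples_or_absorbs_of_neg_eq_self hn hmul hdisj' hmt key ha₂ hb₂ k₂ l₂ h₂ with
      rfl | p₂
    · have cancel : ∀ {a : A}, a ∈ T → ∀ {k l : ℕ}, IsQuasiZero n (k * a + n (l * a)) →
          IsQuasiZero n ((k + l : ℕ) : A) := by
        intro a ha k l h
        obtain ⟨s, -, hs⟩ := hgrp a ha
        convert h.mul_right hmul s using 1
        calc ((k + l : ℕ) : A) = (k + l) * (a * s) := by rw [hs]; push_cast; ring
          _ = (k * a + n (l * a)) * s := by rw [hn]; ring
      have := mul_add_mul_mem_of_even_mem (S := {m : ℕ | IsQuasiZero n (m : A)})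
        (by simpa using isQuasiZero_zero hmul)
        (fun m hm j => by
          have := IsQuasiZero.add hadd hm ⟨(j : A), rfl⟩
          rw [hn, ← two_mul] at this
          simpa using this) (cancel ha₁ h₁) (cancel ha₂ h₂)
      change IsQuasiZero n _
      convert IsQuasiZero.mul_right hmul this (a₁ * a₂) using 1
      rw [hn]
      push_cast
      ring
    · have := p₂.mul_multiple hadd hinv hmul h₁
      rwa [mul_comm, mul_comm (_ * _ : A) (l₁ * a₁)] at this
    · exact p₁.mul_multiple hadd hinv hmul h₂
    · exact p₁.mul hadd hinv hmul p₂
  · have hne : ∀ a ∈ T, a ≠ n a := by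
      intro a ha h
      obtain ⟨s, -, hs⟩ := hgrp a ha
      exact hn1 (by rw [← hs, hmul, ← h])
    have absorb {a b : A} (ha : a ∈ T) (hb : b ∈ T) :
        a + n a + b = a + n a ∨ a + n a + b = b := by
      by_cases hab : b = n a
      · have hna := hTn a ha
        have hb' : n a ≠ n (n a) := hne _ hna
        rcases key hna hna hb' with h | h
        · exact .inl (by rw [hab, add_assoc, h])
        · exact .inr (by rw [hab]; rwa [hinv, add_comm (n a) a] at h)
      · rcases key ha hb hab with h | h
        · exact .inl (by rw [add_right_comm, h])
        · exact .inr h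
    have cls := eq_zero_or_mem_or_eq_add_neg hgen hmt absorb
    have tangible_absorbs : ∀ {x y : A}, x ∈ T → IsQuasiZero n (x + n y) →
        x = y ∨ QuasiZeroAbsorbs n x y := by
      intro x y hx h
      rcases cls y with rfl | hy | ⟨b, hb, rfl⟩
      · exact absurd (by simpa [neg_zero_of_neg_mul hmul] using h) (hdisj' x hx)
      · have := huq' _ hx _ (hTn y hy) h
        exact .inl (by rw [← hinv x, ← this, hinv])
      · have q : IsQuasiZero n (b + n b) := ⟨b, rfl⟩
        rw [q.neg_eq hadd hinv, add_comm] at h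
        rcases absorb hb hx with e | e
        · exact .inr (.inr (.inl ⟨q, by rwa [add_comm]⟩))
        · exact absurd (e ▸ h) (hdisj' x hx)
    have dich : ∀ {x y : A}, IsQuasiZero n (x + n y) → x = y ∨ QuasiZeroAbsorbs n x y := by
      intro x y h
      have zero_or {x : A} (hx : x ∉ T) : IsQuasiZero n x := by
        rcases cls x with rfl | hx' | ⟨b, -, rfl⟩
        · exact isQuasiZero_zero hmul
        · exact absurd hx' hx
        · exact ⟨b, rfl⟩
      by_cases hx : x ∈ T
      · exact tangible_absorbs hx h
      by_cases hy : y ∈ T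
      · exact (tangible_absorbs hy (isQuasiZero_add_neg_comm hadd hinv h)).imp Eq.symm
          QuasiZeroAbsorbs.symm
      · exact .inr (.inl ⟨zero_or hx, zero_or hy⟩)
    rcases dich h₁ with rfl | p₁
    · have := IsQuasiZero.mul_right hmul h₂ x₁
      rw [add_mul, ← hmul] at this
      rwa [mul_comm x₁, mul_comm x₁]
    rcases dich h₂ with rfl | p₂
    · have := IsQuasiZero.mul_right hmul h₁ x₂
      rwa [add_mul, ← hmul] at this
    · exact p₁.mul hadd hinv hmul p₂
end

section
/- Let (A,T,n) be a meta-tangible T-triple with unique quasi-negatives. If a,b,c ∈ T and a ⪯∘ b + c (i.e., b + c = a + (d + n(d)) for some d ∈ A), then b ⪯∘ a + n(c) (i.e., a + n(c) = b + (w + n(w)) for some w ∈ A). -/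
/-- Lemma 7.43: in a meta-tangible T-system, if a ⪯∘ b + c for a,b,c ∈ T,
then b ⪯∘ a + n(c). -/
theorem stmt18 {A : Type*} [CommSemiring A] (n : A → A) (T : Set A)
    (hadd : ∀ x y : A, n (x + y) = n x + n y)
    (hinv : ∀ x : A, n (n x) = x)
    (hmul : ∀ x y : A, n (x * y) = n x * y)
    (hone : (1 : A) ∈ T)
    (hTmul : ∀ a ∈ T, ∀ b ∈ T, a * b ∈ T)
    (hTn : ∀ a ∈ T, n a ∈ T)
    (hdisj : ∀ a ∈ T, ¬ ∃ x : A, a = x + n x)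
    (hgen : ∀ c : A, c ≠ 0 → ∃ l : List A, (∀ x ∈ l, x ∈ T) ∧ l.sum = c)
    (huq : ∀ a ∈ T, ∀ b ∈ T, (∃ x : A, a + b = x + n x) → b = n a)
    (hmt : ∀ a ∈ T, ∀ b ∈ T, b ≠ n a → a + b ∈ T) :
    ∀ a ∈ T, ∀ b ∈ T, ∀ c ∈ T,
      (∃ d : A, b + c = a + (d + n d)) →
      ∃ w : A, a + n c = b + (w + n w) := by
  have n_inj : ∀ x y : A, n x = n y → x = y := fun x y h => by rw [← hinv x, h, hinv]
  have n_zero : n 0 = 0 := by simpa using hmul 0 0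
  -- a tangible element of the form `a + x + n x` with `a` tangible equals `a`
  have eq_of_surpass : ∀ a ∈ T, ∀ s ∈ T, ∀ x : A, s = a + (x + n x) → s = a := by
    intro a ha s hs x h
    refine (n_inj _ _ (huq s hs (n a) (hTn a ha) ⟨a + x, ?_⟩)).symm
    rw [h, hadd]
    ac_rfl
  rintro a ha b hb c hc ⟨d, hd⟩
  by_cases hcb : c = n b
  · subst hcb
    have hd' : b + n b = n a + (d + n d) := by
      have h := congrArg n hd
      simp only [hadd, hinv] at h
      rw [add_comm b, h, add_comm d]
    rw [hinv]
    by_cases hba : b = n a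
    · refine ⟨d, ?_⟩
      subst hba
      rw [← hd', hinv, add_comm]
    by_cases hab : a + b = b
    · exact ⟨0, by simp [hab, n_zero]⟩
    have hmem : a + b + n b ∈ T :=
      hmt _ (hmt a ha b hb hba) _ (hTn b hb) fun h => hab (n_inj _ _ h).symm
    have heq : a + b + n b = a := eq_of_surpass a ha _ hmem b (add_assoc _ _ _)
    refine absurd ⟨a + d, ?_⟩ (hdisj a ha)
    calc a = a + (b + n b) := by rw [← add_assoc, heq]
      _ = a + d + n (a + d) := by rw [hd', hadd]; ac_rfl
  · have heq : b + c = a := eq_of_surpass a ha _ (hmt b hb c hc hcb) d hd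
    exact ⟨c, by rw [← heq, add_assoc]⟩
end

section
/- Let (A,T,n) be a meta-tangible T-triple with unique quasi-negatives, of the second kind (n(a) ≠ a for all a ∈ T), such that T is a group under multiplication. Then (A,T,n) is (−)-bipotent if and only if A is additively idempotent, i.e., a + a = a for all a ∈ A. -/
/-- Corollary 7.23: a meta-tangible T-triple of the second kind (with T a
group) is (−)-bipotent if and only if A is additively idempotent. -/
theorem stmt19 {A : Type*} [CommSemiring A] (n : A → A) (T : Set A)
    (hadd : ∀ x y : A, n (x + y) = n x + n y)
    (hinv : ∀ x : A, n (n x) = x)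
    (hmul : ∀ x y : A, n (x * y) = n x * y)
    (hone : (1 : A) ∈ T)
    (hTmul : ∀ a ∈ T, ∀ b ∈ T, a * b ∈ T)
    (hTn : ∀ a ∈ T, n a ∈ T)
    (hdisj : ∀ a ∈ T, ¬ ∃ x : A, a = x + n x)
    (hgen : ∀ c : A, c ≠ 0 → ∃ l : List A, (∀ x ∈ l, x ∈ T) ∧ l.sum = c)
    (huq : ∀ a ∈ T, ∀ b ∈ T, (∃ x : A, a + b = x + n x) → b = n a)
    (hmt : ∀ a ∈ T, ∀ b ∈ T, b ≠ n a → a + b ∈ T)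
    (hsk : ∀ a ∈ T, n a ≠ a)
    (hgrp : ∀ t ∈ T, ∃ s ∈ T, t * s = 1) :
    (∀ a ∈ T, ∀ b ∈ T, b ≠ n a → a + b = a ∨ a + b = b) ↔
    (∀ a : A, a + a = a) := by
  constructor
  · intro h a
    have h1 : (1 : A) + 1 = 1 := by simpa using h 1 hone 1 hone (hsk 1 hone).symm
    rw [← mul_one a, ← mul_add, h1]
  · intro hid a ha b hb hab
    by_contra! hne
    have key : ∀ x ∈ T, ∀ y ∈ T, y ≠ n x → x + y ≠ x → y = x + y + n x := by
      intro x hx y hy hxy hc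
      have hd : x + y + n x ∈ T := by
        refine hmt _ (hmt x hx y hy hxy) _ (hTn x hx) fun h => hc ?_
        rw [← hinv (x + y), ← h, hinv]
      have h := huq _ hd _ (hTn y hy) ⟨x + y, by rw [hadd, add_assoc]⟩
      exact (hinv y).symm.trans ((congrArg n h).trans (hinv _))
    have hba : a ≠ n b := fun h => hab (by rw [h, hinv])
    have h1 := key a ha b hb hab hne.1
    have h2 := key b hb a ha hba (by rw [add_comm]; exact hne.2)
    refine hdisj _ (hmt a ha b hb hab) ⟨a + b, ?_⟩
    calc a + b = (b + a + n b) + (a + b + n a) := by rw [← h2, ← h1]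
      _ = ((a + b) + (a + b)) + (n a + n b) := by ring
      _ = a + b + n (a + b) := by rw [hid, hadd]
end
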